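/- Suppose I(C) is generated by the five Case 2(b) binomials f1 = x1^{a1} − x2^{a12}x3^{a13}, f2 = x2^{a2} − x1^{a21}x4^{a24}, f3 = x3^{a3} − x2^{a32}x4^{a34}, f4 = x4^{a4} − x1^{a41}x3^{a43}, f5 = x1^{a41}x2^{a32} − x3^{a13}x4^{a24}, where n1 < n2 < n3 < n4, a2 ≤ a21 + a24 and a3 ≤ a32 + a34. Then the ideal I(C)_* of initial forms is generated by one of the following four sets: {x2^{a12}x3^{a13}, x2^{a2}, x3^{a3}, x4^{a4}, x3^{a13}x4^{a24}}, {x2^{a12}x3^{a13}, x2^{a2} − x1^{a21}x4^{a24}, x3^{a3}, x4^{a4}, x3^{a13}x4^{a24}}, {x2^{a12}x3^{a13}, x2^{a2}, x3^{a3} − x2^{a32}x4^{a34}, x4^{a4}, x3^{a13}x4^{a24}}, or {x2^{a12}x3^{a13}, x2^{a2} − x1^{a21}x4^{a24}, x3^{a3} − x2^{a32}x4^{a34}, x4^{a4}, x3^{a13}x4^{a24}}; in particular I(C)_* is minimally generated by five elements. -/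

import Mathlib

open MvPolynomial

/-- The initial form `f_*` of a multivariate polynomial `f`: the homogeneous
component of `f` of least degree (for `f = 0` this is `0`). -/
noncomputable def initialForm {k : Type*} [Field k]
    (f : MvPolynomial (Fin 4) k) : MvPolynomial (Fin 4) k :=
  homogeneousComponent (sInf {n | homogeneousComponent n f ≠ 0}) f

section StandardBasis

variable {k σ ι : Type*} [Field k]

/-- The substitution `xᵢ ↦ t ^ nᵢ` sends a monomial to the power of `t` given by its weight. -/
lemma aeval_X_pow_monomial (n : σ → ℕ) (m : σ →₀ ℕ) (c : k) :
    aeval (fun i => (Polynomial.X : Polynomial k) ^ n i) (monomial m c) =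
      Polynomial.monomial (Finsupp.weight n m) c := by
  rw [aeval_monomial, Finsupp.weight_apply, ← Polynomial.C_mul_X_pow_eq_monomial,
    Polynomial.algebraMap_eq, Finsupp.prod, Finsupp.sum, ← Finset.prod_pow_eq_pow_sum]
  simp only [← pow_mul, smul_eq_mul, mul_comm]

lemma monomial_sub_monomial_mem_ker_iff (n : σ → ℕ) (a b : σ →₀ ℕ) :
    (monomial a 1 - monomial b 1 : MvPolynomial σ k) ∈ RingHom.ker
      (aeval (fun i => (Polynomial.X : Polynomial k) ^ n i) : MvPolynomial σ k →ₐ[k] _) ↔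
      Finsupp.weight n a = Finsupp.weight n b := by
  rw [RingHom.mem_ker, map_sub, aeval_X_pow_monomial, aeval_X_pow_monomial, sub_eq_zero]
  exact Polynomial.monomial_left_inj one_ne_zero

/-- A set of exponents saturated under the rewriting rules `L j ↔ T j` does not separate two
monomials which agree modulo the binomials `x ^ L j - x ^ T j`. -/
lemma mem_iff_mem_of_sub_mem_span {L T : ι → σ →₀ ℕ} {A : Set (σ →₀ ℕ)}
    (hA : ∀ j u, L j + u ∈ A ↔ T j + u ∈ A) {p q : σ →₀ ℕ}
    (h : (monomial p 1 - monomial q 1 : MvPolynomial σ k) ∈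
      Ideal.span (Set.range fun j => (monomial (L j) 1 - monomial (T j) 1 : MvPolynomial σ k))) :
    p ∈ A ↔ q ∈ A := by
  classical
  let φ : MvPolynomial σ k →ₗ[k] k :=
    (basisMonomials σ k).constr k fun m => if m ∈ A then 1 else 0
  have hφ (m) : φ (monomial m 1) = if m ∈ A then 1 else 0 := by
    simpa [coe_basisMonomials] using
      (basisMonomials σ k).constr_basis k (fun m => if m ∈ A then (1 : k) else 0) m
  have hvanish (f) (hf : f ∈ Ideal.span
      (Set.range fun j => (monomial (L j) 1 - monomial (T j) 1 : MvPolynomial σ k)))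
      (a : MvPolynomial σ k) : φ (a • f) = 0 := by
    induction hf using Submodule.span_induction generalizing a with
    | zero => simp
    | add x y _ _ hx hy => rw [smul_add, map_add, hx, hy, add_zero]
    | smul b x _ hx => rw [smul_smul]; exact hx _
    | mem x hx =>
      obtain ⟨j, rfl⟩ := hx
      induction a using MvPolynomial.induction_on' with
      | monomial u c =>
        have hu : φ ((monomial u 1 : MvPolynomial σ k) •
            (monomial (L j) 1 - monomial (T j) 1 : MvPolynomial σ k)) = 0 := by
          rw [smul_eq_mul, mul_sub, monomial_mul, monomial_mul, one_mul, map_sub, hφ, hφ,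
            add_comm u, add_comm u]
          simp only [hA j u, sub_self]
        have hc : (monomial u c : MvPolynomial σ k) = c • monomial u 1 := by
          rw [smul_monomial, smul_eq_mul, mul_one]
        rw [hc, smul_assoc, map_smul, hu, smul_zero]
      | add p q hp hq => rw [add_smul, map_add, hp, hq, add_zero]
  have := hvanish _ h 1
  rw [one_smul, map_sub, hφ, hφ, sub_eq_zero] at this
  by_cases hp : p ∈ A <;> by_cases hq : q ∈ A <;> simp_all

/-- The least-degree part of the binomial `x ^ a - x ^ b` when `a.degree ≤ b.degree`. -/
noncomputable def binomialForm (k : Type*) [Field k] (a b : σ →₀ ℕ) : MvPolynomial σ k :=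
  monomial a 1 - if b.degree = a.degree then monomial b 1 else 0

/-- Every monomial can be rewritten, without lowering its degree, to one which is divisible by no
`x ^ L j`; modulo the forms of the binomials nothing but terms of larger degree is lost. -/
lemma exists_standard_monomial (n : σ → ℕ) {L T : ι → σ →₀ ℕ}
    (hdeg : ∀ j, (L j).degree ≤ (T j).degree)
    (hwt : ∀ j, Finsupp.weight n (L j) = Finsupp.weight n (T j))
    (hwf : WellFounded fun m' m : σ →₀ ℕ => ∃ j u, m = L j + u ∧ m' = T j + u)
    {J : Ideal (MvPolynomial σ k)} (hJ : ∀ j, binomialForm k (L j) (T j) ∈ J) (m : σ →₀ ℕ) :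
    ∃ s, (∀ j, ¬ L j ≤ s) ∧ Finsupp.weight n s = Finsupp.weight n m ∧
      ((m.degree < s.degree ∧ monomial m 1 ∈ J) ∨
        (m.degree = s.degree ∧ monomial m 1 - monomial s 1 ∈ J)) := by
  induction m using hwf.induction with
  | _ m ih =>
  by_cases hm : ∀ j, ¬ L j ≤ m
  · exact ⟨m, hm, rfl, Or.inr ⟨rfl, by simp⟩⟩
  push Not at hm
  obtain ⟨j, hj⟩ := hm
  obtain ⟨u, rfl⟩ := exists_add_of_le hj
  obtain ⟨s, hs, hsw, h⟩ := ih (T j + u) ⟨j, u, rfl, rfl⟩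
  refine ⟨s, hs, by rw [hsw, map_add, map_add, hwt], ?_⟩
  have hu := J.mul_mem_left (monomial u 1) (hJ j)
  simp only [map_add] at h ⊢
  have hd := hdeg j
  by_cases heq : (T j).degree = (L j).degree
  · rw [binomialForm, if_pos heq, mul_sub, monomial_mul, monomial_mul, one_mul, add_comm u,
      add_comm u] at hu
    rw [← heq]
    refine h.imp (And.imp_right fun h => ?_) (And.imp_right fun h => ?_)
    · simpa using J.add_mem hu h
    · simpa using J.add_mem hu h
  · rw [binomialForm, if_neg heq, sub_zero, monomial_mul, one_mul, add_comm u] at hu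
    refine Or.inl ⟨?_, hu⟩
    have := h.elim (fun h => h.1.le) (fun h => h.1.le)
    omega

/-- If every monomial agrees with the normal form of its weight modulo an ideal, up to dropping
monomials of too small degree, then the ideal contains all the initial forms of the kernel of
`xᵢ ↦ t ^ nᵢ`. -/
lemma homogeneousComponent_mem_of_normalForm (n : σ → ℕ) {J : Ideal (MvPolynomial σ k)}
    (nf : ℕ → σ →₀ ℕ)
    (hnf : ∀ m, (m.degree < (nf (Finsupp.weight n m)).degree ∧ monomial m 1 ∈ J) ∨
      (m.degree = (nf (Finsupp.weight n m)).degree ∧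
        monomial m 1 - monomial (nf (Finsupp.weight n m)) 1 ∈ J))
    {f : MvPolynomial σ k} (hf : f ∈ RingHom.ker
      (aeval (fun i => (Polynomial.X : Polynomial k) ^ n i) : MvPolynomial σ k →ₐ[k] _))
    (d : ℕ) (hd : ∀ m ∈ f.support, d ≤ m.degree) :
    homogeneousComponent d f ∈ J := by
  classical
  let h : ℕ → MvPolynomial σ k := fun w => if (nf w).degree = d then monomial (nf w) 1 else 0
  let Λ : Polynomial k →ₗ[k] MvPolynomial σ k := Polynomial.lsum fun w =>
    LinearMap.toSpanSingleton k _ (h w)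
  have hΛ (w) (c : k) : Λ (Polynomial.monomial w c) = c • h w := by
    simp [Λ, Polynomial.lsum_apply, Polynomial.sum_monomial_index]
  have key : homogeneousComponent d f -
      Λ (aeval (fun i => (Polynomial.X : Polynomial k) ^ n i) f) ∈ J := by
    rw [homogeneousComponent_apply, Finset.sum_filter]
    conv in aeval _ _ => rw [f.as_sum]
    rw [map_sum, map_sum, ← Finset.sum_sub_distrib]
    refine J.sum_mem fun m hm => ?_
    rw [aeval_X_pow_monomial, hΛ]
    have hc : monomial m (coeff m f) = coeff m f • (monomial m 1 : MvPolynomial σ k) := by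
      rw [smul_monomial, smul_eq_mul, mul_one]
    rw [hc]
    have hdm := hd m hm
    have hsmul (c : k) {x : MvPolynomial σ k} (hx : x ∈ J) : c • x ∈ J := by
      rw [smul_eq_C_mul]; exact J.mul_mem_left _ hx
    rcases hnf m with ⟨h1, h2⟩ | ⟨h1, h2⟩
    · have : ¬ (nf (Finsupp.weight n m)).degree = d := by omega
      simp only [h, if_neg this, smul_zero, sub_zero]
      split_ifs
      · exact hsmul _ h2
      · exact J.zero_mem
    · simp only [h, ← h1]
      split_ifs
      · rw [← smul_sub]; exact hsmul _ h2
      · simp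
  rwa [RingHom.mem_ker.mp hf, map_zero, sub_zero] at key

/-- If `ψ` is linear, `ψ (p * gᵢ) = p(0) eᵢ`, then the ideal generated by the family `g` needs as
many generators as `g` has members. -/
lemma card_le_card_of_span_eq_span_range [Fintype ι] [DecidableEq ι] (g : ι → MvPolynomial σ k)
    (μ : ι → σ →₀ ℕ)
    (hμ : ∀ i j p, coeff (μ i) (p * g j) = if i = j then constantCoeff p else 0)
    (S : Finset (MvPolynomial σ k))
    (hS : Ideal.span (S : Set (MvPolynomial σ k)) = Ideal.span (Set.range g)) :
    Fintype.card ι ≤ S.card := by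
  classical
  let ψ : MvPolynomial σ k →ₗ[k] ι → k := LinearMap.pi fun i => lcoeff k (μ i)
  have hψ (j p) : ψ (p * g j) = constantCoeff p • Pi.single j 1 := by
    ext i
    simp [ψ, hμ, Pi.single_apply]
  have hmul (p h) (hh : h ∈ Ideal.span (Set.range g)) : ψ (p * h) = constantCoeff p • ψ h := by
    obtain ⟨c, rfl⟩ := Ideal.mem_span_range_iff_exists_fun.mp hh
    simp only [Finset.mul_sum, ← mul_assoc, map_sum, hψ, Finset.smul_sum, map_mul, smul_smul]
  have htop : Submodule.span k (S.image ψ : Set (ι → k)) = ⊤ := by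
    rw [eq_top_iff, ← (Pi.basisFun k ι).span_eq, Submodule.span_le]
    rintro _ ⟨j, rfl⟩
    have hj : g j ∈ Ideal.span (S : Set (MvPolynomial σ k)) :=
      hS ▸ Ideal.subset_span ⟨j, rfl⟩
    obtain ⟨c, -, hc⟩ := Submodule.mem_span_finset.mp hj
    have h1 : ψ (g j) = Pi.single j 1 := by simpa using hψ j 1
    rw [Pi.basisFun_apply, ← h1, ← hc, map_sum]
    refine Submodule.sum_mem _ fun s hs => ?_
    rw [smul_eq_mul, hmul _ _ (hS ▸ Ideal.subset_span hs)]
    exact Submodule.smul_mem _ _ (Submodule.subset_span (by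
      simpa using ⟨s, hs, rfl⟩))
  have h := finrank_span_finset_le_card (R := k) (S.image ψ)
  rw [Set.finrank, htop, finrank_top, Module.finrank_fintype_fun_eq_card] at h
  exact h.trans Finset.card_image_le

end StandardBasis

section InitialForm

variable {k : Type*} [Field k]

lemma initialForm_eq_of_homogeneousComponent {f : MvPolynomial (Fin 4) k} {n : ℕ}
    (h0 : homogeneousComponent n f ≠ 0) (hlt : ∀ m < n, homogeneousComponent m f = 0) :
    initialForm f = homogeneousComponent n f := by
  have : sInf {n | homogeneousComponent n f ≠ 0} = n :=
    le_antisymm (Nat.sInf_le h0)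
      (le_csInf ⟨n, h0⟩ fun m hm => not_lt.mp fun hmn => hm (hlt m hmn))
  rw [initialForm, this]

lemma initialForm_monomial_sub_monomial {a b : Fin 4 →₀ ℕ} (hab : a ≠ b)
    (hd : a.degree ≤ b.degree) :
    initialForm (monomial a 1 - monomial b 1 : MvPolynomial (Fin 4) k) = binomialForm k a b := by
  have hcomp (m : ℕ) (c : Fin 4 →₀ ℕ) :
      homogeneousComponent m (monomial c 1 : MvPolynomial (Fin 4) k) =
        if m = c.degree then monomial c 1 else 0 :=
    homogeneousComponent_of_mem (isHomogeneous_monomial 1 rfl)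
  have hform : homogeneousComponent a.degree
      (monomial a 1 - monomial b 1 : MvPolynomial (Fin 4) k) = binomialForm k a b := by
    rw [map_sub, hcomp, hcomp, if_pos rfl, binomialForm]
    simp only [eq_comm]
  rw [initialForm_eq_of_homogeneousComponent (n := a.degree), hform]
  · rw [hform]
    intro h
    have := congrArg (coeff a) h
    rw [binomialForm] at this
    split_ifs at this <;> simp [coeff_monomial, hab.symm] at this
  · intro m hm
    rw [map_sub, hcomp, hcomp, if_neg (by omega), if_neg (by omega), sub_zero]

lemma le_degree_of_mem_support {f : MvPolynomial (Fin 4) k} {m : Fin 4 →₀ ℕ}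
    (hm : m ∈ f.support) : sInf {n | homogeneousComponent n f ≠ 0} ≤ m.degree := by
  refine Nat.sInf_le fun h => ?_
  have := congrArg (coeff m) h
  rw [coeff_homogeneousComponent, if_pos rfl, coeff_zero] at this
  exact mem_support_iff.mp hm this

/-- A criterion for a family of binomials to be a standard basis of the ideal of a monomial
curve: rewriting `L j` to `T j` terminates, does not lower degrees, and its normal forms are
determined by their weights. -/
lemma span_initialForm_eq_span_binomialForm {ι : Type*} (n : Fin 4 → ℕ)
    {L T : ι → Fin 4 →₀ ℕ} (hne : ∀ j, L j ≠ T j)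
    (hdeg : ∀ j, (L j).degree ≤ (T j).degree)
    (hwt : ∀ j, Finsupp.weight n (L j) = Finsupp.weight n (T j))
    (hwf : WellFounded fun m' m : Fin 4 →₀ ℕ => ∃ j u, m = L j + u ∧ m' = T j + u)
    (huniq : ∀ s s' : Fin 4 →₀ ℕ, (∀ j, ¬ L j ≤ s) → (∀ j, ¬ L j ≤ s') →
      Finsupp.weight n s = Finsupp.weight n s' → s = s') :
    Ideal.span {g | ∃ f ∈ RingHom.ker
      (aeval (fun i => (Polynomial.X : Polynomial k) ^ n i) : MvPolynomial (Fin 4) k →ₐ[k] _),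
        g = initialForm f} = Ideal.span (Set.range fun j => binomialForm k (L j) (T j)) := by
  classical
  apply le_antisymm
  · set J := Ideal.span (Set.range fun j => binomialForm k (L j) (T j)) with hJ
    have hex := exists_standard_monomial (k := k) n hdeg hwt hwf (J := J)
      fun j => Ideal.subset_span ⟨j, rfl⟩
    let nf : ℕ → Fin 4 →₀ ℕ := fun w =>
      if h : ∃ s : Fin 4 →₀ ℕ, (∀ j, ¬ L j ≤ s) ∧ Finsupp.weight n s = w then h.choose else 0
    rw [Ideal.span_le]
    rintro _ ⟨f, hf, rfl⟩
    refine homogeneousComponent_mem_of_normalForm n nf (fun m => ?_) hf _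
      fun m hm => le_degree_of_mem_support hm
    obtain ⟨s, hs, hsw, h⟩ := hex m
    have hexs : ∃ s : Fin 4 →₀ ℕ, (∀ j, ¬ L j ≤ s) ∧ Finsupp.weight n s = Finsupp.weight n m :=
      ⟨s, hs, hsw⟩
    have : nf (Finsupp.weight n m) = s := by
      simp only [nf, dif_pos hexs]
      exact huniq _ _ hexs.choose_spec.1 hs (hexs.choose_spec.2.trans hsw.symm)
    rwa [this]
  · rw [Ideal.span_le]
    rintro _ ⟨j, rfl⟩
    exact Ideal.subset_span ⟨_, (monomial_sub_monomial_mem_ker_iff n _ _).mpr (hwt j),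
      (initialForm_monomial_sub_monomial (hne j) (hdeg j)).symm⟩

end InitialForm

section Bresinsky

/-- The exponent vector of `x₁ ^ a * x₂ ^ b * x₃ ^ c * x₄ ^ d`. -/
noncomputable def expVec (a b c d : ℕ) : Fin 4 →₀ ℕ := Finsupp.equivFunOnFinite.symm ![a, b, c, d]

lemma expVec_apply (a b c d : ℕ) (i : Fin 4) : expVec a b c d i = ![a, b, c, d] i := rfl

lemma expVec_le_iff {a b c d : ℕ} {m : Fin 4 →₀ ℕ} :
    expVec a b c d ≤ m ↔ a ≤ m 0 ∧ b ≤ m 1 ∧ c ≤ m 2 ∧ d ≤ m 3 := by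
  simp [Finsupp.le_def, Fin.forall_fin_succ, expVec_apply]

lemma degree_expVec (a b c d : ℕ) : (expVec a b c d).degree = a + b + c + d := by
  simp [Finsupp.degree_eq_sum, Fin.sum_univ_four, expVec_apply]

lemma weight_expVec (n : Fin 4 → ℕ) (a b c d : ℕ) :
    Finsupp.weight n (expVec a b c d) = a * n 0 + b * n 1 + c * n 2 + d * n 3 := by
  simp [Finsupp.weight_eq_sum, Fin.sum_univ_four, expVec_apply]

lemma monomial_expVec {k : Type*} [CommSemiring k] (a b c d : ℕ) :
    (monomial (expVec a b c d) 1 : MvPolynomial (Fin 4) k) =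
      X 0 ^ a * X 1 ^ b * X 2 ^ c * X 3 ^ d := by
  rw [monomial_eq, Finsupp.prod_fintype _ _ (by simp), Fin.prod_univ_four]
  simp [expVec_apply]

lemma degree_le_weight {n : Fin 4 → ℕ} (hn : ∀ i, 0 < n i) (m : Fin 4 →₀ ℕ) :
    m.degree ≤ Finsupp.weight n m := by
  rw [Finsupp.degree_eq_sum, Finsupp.weight_eq_sum]
  exact Finset.sum_le_sum fun i _ => Nat.le_mul_of_pos_right _ (hn i)

/-- Exponents of the terms of least degree of the five binomials. -/
noncomputable def leadExp (a12 a32 a13 a43 a24 a34 : ℕ) : Fin 5 → Fin 4 →₀ ℕ :=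
  ![expVec 0 a12 a13 0, expVec 0 (a12 + a32) 0 0, expVec 0 0 (a13 + a43) 0,
    expVec 0 0 0 (a24 + a34), expVec 0 0 a13 a24]

/-- Exponents of the other terms of the five binomials. -/
noncomputable def tailExp (a21 a41 a32 a43 a24 a34 : ℕ) : Fin 5 → Fin 4 →₀ ℕ :=
  ![expVec (a21 + a41) 0 0 0, expVec a21 0 0 a24, expVec 0 a32 0 a34,
    expVec a41 0 a43 0, expVec a41 a32 0 0]

variable {a21 a41 a12 a32 a13 a43 a24 a34 : ℕ}

lemma forall_not_leadExp_le_iff {s : Fin 4 →₀ ℕ} :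
    (∀ j, ¬ leadExp a12 a32 a13 a43 a24 a34 j ≤ s) ↔
      ¬ (a12 ≤ s 1 ∧ a13 ≤ s 2) ∧ s 1 < a12 + a32 ∧ s 2 < a13 + a43 ∧ s 3 < a24 + a34 ∧
        ¬ (a13 ≤ s 2 ∧ a24 ≤ s 3) := by
  simp [Fin.forall_fin_succ, leadExp, expVec_le_iff]

lemma wellFounded_rewriting {n : Fin 4 → ℕ} (hn : ∀ i, 0 < n i)
    (h21 : 0 < a21) (h13 : 0 < a13)
    (hd0 : a12 + a13 < a21 + a41) (hd1 : a12 + a32 ≤ a21 + a24) (hd2 : a13 + a43 ≤ a32 + a34)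
    (hd3 : a24 + a34 < a41 + a43) (hd4 : a13 + a24 < a41 + a32)
    (hwt : ∀ j, Finsupp.weight n (leadExp a12 a32 a13 a43 a24 a34 j) =
      Finsupp.weight n (tailExp a21 a41 a32 a43 a24 a34 j)) :
    WellFounded fun m' m : Fin 4 →₀ ℕ => ∃ j u,
      m = leadExp a12 a32 a13 a43 a24 a34 j + u ∧ m' = tailExp a21 a41 a32 a43 a24 a34 j + u := by
  let F (m : Fin 4 →₀ ℕ) : ℕ × ℕ × ℕ :=
    (Finsupp.weight n m - m.degree, Finsupp.weight n m - m 0, m 2)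
  refine Subrelation.wf (r := InvImage (Prod.Lex (· < ·) (Prod.Lex (· < ·) (· < ·))) F) ?_
    (InvImage.wf F (wellFounded_lt.prod_lex (wellFounded_lt.prod_lex wellFounded_lt)))
  rintro _ _ ⟨j, u, rfl, rfl⟩
  have h1 := degree_le_weight hn (tailExp a21 a41 a32 a43 a24 a34 j + u)
  have h2 := (Finsupp.le_degree 0 _).trans h1
  simp only [InvImage, F, Prod.lex_def]
  simp only [map_add, hwt] at h1 h2 ⊢
  generalize Finsupp.weight n (tailExp a21 a41 a32 a43 a24 a34 j) + Finsupp.weight n u = W at *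
  fin_cases j <;>
  simp [leadExp, tailExp, degree_expVec, expVec_apply] at h1 h2 ⊢ <;> omega

/-- For a standard monomial `s`, the set of monomials free of `x₁` from which the rule
`x₃ ^ a₃ ↦ x₂ ^ a₃₂ * x₄ ^ a₃₄` leads to `s` is saturated under all the rules. -/
lemma leadExp_add_mem_iff {s : Fin 4 →₀ ℕ}
    (h21 : 0 < a21) (h41 : 0 < a41)
    (hs : ∀ j, ¬ leadExp a12 a32 a13 a43 a24 a34 j ≤ s) (j : Fin 5) (u : Fin 4 →₀ ℕ) :
    leadExp a12 a32 a13 a43 a24 a34 j + u ∈ {m : Fin 4 →₀ ℕ | m 0 = 0 ∧ ∃ q,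
      m 2 = s 2 + q * (a13 + a43) ∧ m 1 + q * a32 = s 1 ∧ m 3 + q * a34 = s 3} ↔
    tailExp a21 a41 a32 a43 a24 a34 j + u ∈ {m : Fin 4 →₀ ℕ | m 0 = 0 ∧ ∃ q,
      m 2 = s 2 + q * (a13 + a43) ∧ m 1 + q * a32 = s 1 ∧ m 3 + q * a34 = s 3} := by
  rw [forall_not_leadExp_le_iff] at hs
  obtain ⟨hs1, hs2, hs3, hs4, hs5⟩ := hs
  have hlead (m : Fin 4 →₀ ℕ) : m ∈ {m : Fin 4 →₀ ℕ | m 0 = 0 ∧ ∃ q,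
      m 2 = s 2 + q * (a13 + a43) ∧ m 1 + q * a32 = s 1 ∧ m 3 + q * a34 = s 3} →
      ∀ j, j ≠ 2 → ¬ leadExp a12 a32 a13 a43 a24 a34 j ≤ m := by
    rintro ⟨h0, q, h2, h1, h3⟩ j hj hle
    rcases q with _ | q <;> fin_cases j <;>
      simp [leadExp, expVec_le_iff, add_mul] at hj hle h1 h2 h3 <;> omega
  by_cases hj : j = 2
  · subst hj
    constructor
    · rintro ⟨h0, q, h2, h1, h3⟩
      rcases q with _ | q
      · simp [leadExp, expVec_apply] at h2
        omega
      · refine ⟨?_, q, ?_⟩ <;>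
        simp [leadExp, tailExp, expVec_apply, add_mul] at h0 h1 h2 h3 ⊢ <;> omega
    · rintro ⟨h0, q, h2, h1, h3⟩
      refine ⟨?_, q + 1, ?_⟩ <;>
        simp [leadExp, tailExp, expVec_apply, add_mul] at h0 h1 h2 h3 ⊢ <;> omega
  · refine iff_of_false (fun h => hlead _ h j hj le_self_add) fun h => ?_
    have h0 := h.1
    fin_cases j <;> simp [tailExp, expVec_apply] at hj h0 <;> omega

lemma standard_unique {k : Type*} [Field k] {n : Fin 4 → ℕ}
    (h21 : 0 < a21) (h41 : 0 < a41)
    (hker : RingHom.ker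
      (aeval (fun i => (Polynomial.X : Polynomial k) ^ n i) : MvPolynomial (Fin 4) k →ₐ[k] _) ≤
      Ideal.span (Set.range fun j => (monomial (leadExp a12 a32 a13 a43 a24 a34 j) 1 -
        monomial (tailExp a21 a41 a32 a43 a24 a34 j) 1 : MvPolynomial (Fin 4) k)))
    (s s' : Fin 4 →₀ ℕ) (hs : ∀ j, ¬ leadExp a12 a32 a13 a43 a24 a34 j ≤ s)
    (hs' : ∀ j, ¬ leadExp a12 a32 a13 a43 a24 a34 j ≤ s')
    (hw : Finsupp.weight n s = Finsupp.weight n s') : s = s' := by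
  wlog hle : s 0 ≤ s' 0 generalizing s s'
  · exact (this s' s hs' hs hw.symm (le_of_not_ge hle)).symm
  obtain ⟨d, hd⟩ := Nat.exists_eq_add_of_le hle
  have hmem : (monomial (expVec 0 (s 1) (s 2) (s 3)) 1 -
      monomial (expVec d (s' 1) (s' 2) (s' 3)) 1 : MvPolynomial (Fin 4) k) ∈ RingHom.ker
      (aeval (fun i => (Polynomial.X : Polynomial k) ^ n i) : MvPolynomial (Fin 4) k →ₐ[k] _) := by
    rw [monomial_sub_monomial_mem_ker_iff, weight_expVec, weight_expVec]
    simp only [Finsupp.weight_eq_sum, Fin.sum_univ_four, hd, smul_eq_mul] at hw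
    linarith
  obtain ⟨hd0, q, hq2, hq1, hq3⟩ := (mem_iff_mem_of_sub_mem_span
    (leadExp_add_mem_iff h21 h41 hs) (hker hmem)).mp ⟨rfl, 0, by simp [expVec_apply]⟩
  simp only [expVec_apply, Matrix.cons_val] at hd0 hq1 hq2 hq3
  have hq : q = 0 := by
    rw [forall_not_leadExp_le_iff] at hs'
    by_contra hq
    have := Nat.le_mul_of_pos_left (a13 + a43) (Nat.pos_of_ne_zero hq)
    omega
  subst hq
  ext i
  fin_cases i <;> simp <;> omega

lemma coeff_leadExp_mul_binomialForm {k : Type*} [Field k]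
    (h21 : 0 < a21) (h41 : 0 < a41) (h12 : 0 < a12) (h32 : 0 < a32)
    (h13 : 0 < a13) (h43 : 0 < a43) (h24 : 0 < a24) (h34 : 0 < a34)
    (i j : Fin 5) (p : MvPolynomial (Fin 4) k) :
    coeff (leadExp a12 a32 a13 a43 a24 a34 i) (p * binomialForm k
      (leadExp a12 a32 a13 a43 a24 a34 j) (tailExp a21 a41 a32 a43 a24 a34 j)) =
      if i = j then constantCoeff p else 0 := by
  have hT : ¬ tailExp a21 a41 a32 a43 a24 a34 j ≤ leadExp a12 a32 a13 a43 a24 a34 i := by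
    fin_cases i <;> fin_cases j <;>
      simp [leadExp, tailExp, expVec_le_iff, expVec_apply] <;> omega
  have hL : leadExp a12 a32 a13 a43 a24 a34 j ≤ leadExp a12 a32 a13 a43 a24 a34 i ↔ i = j := by
    fin_cases i <;> fin_cases j <;>
      simp [leadExp, expVec_le_iff, expVec_apply] <;> omega
  have h0 : coeff (leadExp a12 a32 a13 a43 a24 a34 i)
      (p * if (tailExp a21 a41 a32 a43 a24 a34 j).degree =
        (leadExp a12 a32 a13 a43 a24 a34 j).degree
        then monomial (tailExp a21 a41 a32 a43 a24 a34 j) 1 else 0) = 0 := by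
    split_ifs
    · rw [coeff_mul_monomial', if_neg hT]
    · simp
  rw [binomialForm, mul_sub, coeff_sub, h0, sub_zero, coeff_mul_monomial']
  simp only [hL, mul_one]
  split_ifs with h
  · rw [h, tsub_self, constantCoeff_eq]
  · rfl

lemma range_fin_five {α : Type*} (g : Fin 5 → α) : Set.range g = {g 0, g 1, g 2, g 3, g 4} := by
  ext
  simp [Fin.exists_fin_succ, eq_comm]

lemma span_range_binomial (k : Type*) [Field k] (a21 a41 a12 a32 a13 a43 a24 a34 : ℕ) :
    Ideal.span (Set.range fun j => (monomial (leadExp a12 a32 a13 a43 a24 a34 j) 1 -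
        monomial (tailExp a21 a41 a32 a43 a24 a34 j) 1 : MvPolynomial (Fin 4) k)) =
      Ideal.span {X 0 ^ (a21 + a41) - X 1 ^ a12 * X 2 ^ a13,
        X 1 ^ (a12 + a32) - X 0 ^ a21 * X 3 ^ a24,
        X 2 ^ (a13 + a43) - X 1 ^ a32 * X 3 ^ a34,
        X 3 ^ (a24 + a34) - X 0 ^ a41 * X 2 ^ a43,
        X 0 ^ a41 * X 1 ^ a32 - X 2 ^ a13 * X 3 ^ a24} := by
  rw [range_fin_five]
  simp only [leadExp, tailExp, monomial_expVec, Matrix.cons_val, pow_zero, one_mul, mul_one]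
  rw [← neg_sub (X 0 ^ (a21 + a41)), ← neg_sub (X 0 ^ a41 * X 1 ^ a32)]
  simp only [Ideal.span_insert, Ideal.span_singleton_neg]

lemma range_binomialForm (k : Type*) [Field k]
    (hd0 : a12 + a13 < a21 + a41) (hd3 : a24 + a34 < a41 + a43) (hd4 : a13 + a24 < a41 + a32) :
    (Set.range fun j => binomialForm k (leadExp a12 a32 a13 a43 a24 a34 j)
        (tailExp a21 a41 a32 a43 a24 a34 j)) =
      {X 1 ^ a12 * X 2 ^ a13,
        X 1 ^ (a12 + a32) - if a21 + a24 = a12 + a32 then X 0 ^ a21 * X 3 ^ a24 else 0,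
        X 2 ^ (a13 + a43) - if a32 + a34 = a13 + a43 then X 1 ^ a32 * X 3 ^ a34 else 0,
        X 3 ^ (a24 + a34),
        X 2 ^ a13 * X 3 ^ a24} := by
  rw [range_fin_five]
  simp only [binomialForm, leadExp, tailExp, monomial_expVec, degree_expVec, Matrix.cons_val,
    pow_zero, one_mul, mul_one, add_zero, zero_add, hd0.ne', hd3.ne', hd4.ne', if_false, sub_zero]

end Bresinsky

theorem tangent_cone_generators_case_2b
    (k : Type*) [Field k]
    (n1 n2 n3 n4 : ℕ)
    (hn1 : 0 < n1) (hn12 : n1 < n2) (hn23 : n2 < n3) (hn34 : n3 < n4)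
    (hgcd : Nat.gcd (Nat.gcd (Nat.gcd n1 n2) n3) n4 = 1)
    (a21 a41 a12 a32 a13 a43 a24 a34 a1 a2 a3 a4 : ℕ)
    (h21 : 0 < a21) (h41 : 0 < a41) (h12 : 0 < a12) (h32 : 0 < a32)
    (h13 : 0 < a13) (h43 : 0 < a43) (h24 : 0 < a24) (h34 : 0 < a34)
    (ha1 : a1 = a21 + a41)
    (ha2 : a2 = a12 + a32)
    (ha3 : a3 = a13 + a43)
    (ha4 : a4 = a24 + a34)
    (hb21 : a21 < a1) (hb41 : a41 < a1) (hb12 : a12 < a2) (hb32 : a32 < a2)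
    (hb13 : a13 < a3) (hb43 : a43 < a3) (hb24 : a24 < a4) (hb34 : a34 < a4)
    (hc1 : a2 ≤ a21 + a24)
    (hc2 : a3 ≤ a32 + a34)
    (x1 x2 x3 x4 : MvPolynomial (Fin 4) k)
    (hx1 : x1 = X 0) (hx2 : x2 = X 1) (hx3 : x3 = X 2) (hx4 : x4 = X 3)
    (IC : Ideal (MvPolynomial (Fin 4) k))
    (hIC : IC = RingHom.ker (aeval
      (fun i : Fin 4 => (Polynomial.X : Polynomial k) ^ (![n1, n2, n3, n4] i)) :
        MvPolynomial (Fin 4) k →ₐ[k] Polynomial k))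
    (hgen : IC = Ideal.span {x1 ^ a1 - x2 ^ a12 * x3 ^ a13,
      x2 ^ a2 - x1 ^ a21 * x4 ^ a24,
      x3 ^ a3 - x2 ^ a32 * x4 ^ a34,
      x4 ^ a4 - x1 ^ a41 * x3 ^ a43,
      x1 ^ a41 * x2 ^ a32 - x3 ^ a13 * x4 ^ a24})
    (Istar : Ideal (MvPolynomial (Fin 4) k))
    (hIstar : Istar = Ideal.span {g | ∃ f ∈ IC, g = initialForm f}) :
    (Istar = Ideal.span {x2 ^ a12 * x3 ^ a13, x2 ^ a2, x3 ^ a3, x4 ^ a4, x3 ^ a13 * x4 ^ a24} ∨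
      Istar = Ideal.span {x2 ^ a12 * x3 ^ a13, x2 ^ a2 - x1 ^ a21 * x4 ^ a24, x3 ^ a3, x4 ^ a4, x3 ^ a13 * x4 ^ a24} ∨
      Istar = Ideal.span {x2 ^ a12 * x3 ^ a13, x2 ^ a2, x3 ^ a3 - x2 ^ a32 * x4 ^ a34, x4 ^ a4, x3 ^ a13 * x4 ^ a24} ∨
      Istar = Ideal.span {x2 ^ a12 * x3 ^ a13, x2 ^ a2 - x1 ^ a21 * x4 ^ a24, x3 ^ a3 - x2 ^ a32 * x4 ^ a34, x4 ^ a4, x3 ^ a13 * x4 ^ a24}) ∧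
    (∃ S : Finset (MvPolynomial (Fin 4) k), S.card = 5 ∧
      Ideal.span (S : Set (MvPolynomial (Fin 4) k)) = Istar) ∧
    (∀ S : Finset (MvPolynomial (Fin 4) k),
      Ideal.span (S : Set (MvPolynomial (Fin 4) k)) = Istar → 5 ≤ S.card) := by
  subst ha1 ha2 ha3 ha4 hx1 hx2 hx3 hx4
  set n : Fin 4 → ℕ := ![n1, n2, n3, n4] with hn
  have hpos : ∀ i, 0 < n i := by
    intro i
    fin_cases i <;> simp [hn] <;> omega
  let L := leadExp a12 a32 a13 a43 a24 a34
  let T := tailExp a21 a41 a32 a43 a24 a34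
  let B (j : Fin 5) : MvPolynomial (Fin 4) k := monomial (L j) 1 - monomial (T j) 1
  let G (j : Fin 5) : MvPolynomial (Fin 4) k := binomialForm k (L j) (T j)
  have hspan : IC = Ideal.span (Set.range B) := hgen.trans (span_range_binomial k _ _ _ _ _ _ _ _).symm
  have hwt : ∀ j, Finsupp.weight n (L j) = Finsupp.weight n (T j) := fun j =>
    (monomial_sub_monomial_mem_ker_iff (k := k) n _ _).mp
      (hIC ▸ hspan ▸ Ideal.subset_span ⟨j, rfl⟩)
  have hw0 := hwt 0
  have hw3 := hwt 3
  have hw4 := hwt 4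
  simp [L, T, leadExp, tailExp, weight_expVec, hn] at hw0 hw3 hw4
  have hd0 : a12 + a13 < a21 + a41 := by nlinarith
  have hd3 : a24 + a34 < a41 + a43 := by nlinarith
  have hd4 : a13 + a24 < a41 + a32 := by nlinarith
  have hIG : Istar = Ideal.span (Set.range G) := by
    rw [hIstar, hIC]
    refine span_initialForm_eq_span_binomialForm n (fun j h => ?_) (fun j => ?_) hwt
      (wellFounded_rewriting hpos h21 h13 hd0 hc1 hc2 hd3 hd4 hwt)
      (standard_unique h21 h41 (hIC ▸ hspan.le))
    · have := coeff_leadExp_mul_binomialForm (k := k) h21 h41 h12 h32 h13 h43 h24 h34 j j 1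
      simp [show leadExp a12 a32 a13 a43 a24 a34 j = tailExp a21 a41 a32 a43 a24 a34 j from h,
        binomialForm] at this
    · fin_cases j <;> simp [L, T, leadExp, tailExp, degree_expVec] <;> omega
  have hcard (S : Finset (MvPolynomial (Fin 4) k))
      (hS : Ideal.span (S : Set (MvPolynomial (Fin 4) k)) = Istar) : 5 ≤ S.card := by
    simpa using card_le_card_of_span_eq_span_range G L
      (coeff_leadExp_mul_binomialForm h21 h41 h12 h32 h13 h43 h24 h34) S (hS.trans hIG)
  refine ⟨?_, ?_, hcard⟩
  · rw [hIG, range_binomialForm k hd0 hd3 hd4]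
    split_ifs <;> simp only [sub_zero, true_or, or_true]
  · classical
    have hS : Ideal.span ((Finset.univ.image G : Finset _) : Set (MvPolynomial (Fin 4) k)) =
        Istar := by
      rw [Finset.coe_image, Finset.coe_univ, Set.image_univ, hIG]
    exact ⟨_, le_antisymm (Finset.card_image_le.trans (by simp)) (hcard _ hS), hS⟩
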